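/- For every integer d ≥ 1 there exists n₀ depending only on d such that for all even n ≥ n₀ and every multilinear polynomial g of degree at most d on n variables, E_D[g⁴] ≤ 12d · 9^{2d} · (E_D[g²])². -/

import Mathlib

open Finset

/-- Evaluation of a multilinear polynomial given its coefficients. -/
noncomputable def evalML {n : ℕ} (c : Finset (Fin n) → ℝ) (x : Fin n → ℝ) : ℝ :=
  ∑ S : Finset (Fin n), c S * ∏ i ∈ S, x i

/-- The ±1 assignment corresponding to a Boolean assignment. -/
def signs {n : ℕ} (σ : Fin n → Bool) : Fin n → ℝ := fun i => if σ i then 1 else -1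

/-- The (integer) sum of the ±1 values of an assignment. -/
def intSum {n : ℕ} (σ : Fin n → Bool) : ℤ := ∑ i, (if σ i then (1 : ℤ) else -1)

/-- The set of assignments satisfying the bisection constraint `∑ i x i = 0`. -/
def bisSet (n : ℕ) : Finset (Fin n → Bool) := Finset.univ.filter fun σ => intSum σ = 0

/-- Expectation of `g` over the uniform distribution on `A`. -/
noncomputable def expOver {n : ℕ} (A : Finset (Fin n → Bool)) (g : (Fin n → Bool) → ℝ) : ℝ :=
  (∑ σ ∈ A, g σ) / A.card

/-- The parity function `σ ↦ ∏ i ∈ S, x i` on the cube. -/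
def chi {n : ℕ} (S : Finset (Fin n)) (σ : Fin n → Bool) : ℝ := ∏ i ∈ S, signs σ i

lemma signs_mul_self {n : ℕ} (σ : Fin n → Bool) (i : Fin n) : signs σ i * signs σ i = 1 := by
  unfold signs; split_ifs <;> norm_num

lemma chi_eq_prod_univ {n : ℕ} (S : Finset (Fin n)) (σ : Fin n → Bool) :
    chi S σ = ∏ i, if i ∈ S then signs σ i else 1 := by
  simp [chi]

lemma chi_mul {n : ℕ} (S T : Finset (Fin n)) (σ : Fin n → Bool) :
    chi S σ * chi T σ = chi (symmDiff S T) σ := by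
  rw [chi_eq_prod_univ, chi_eq_prod_univ, chi_eq_prod_univ, ← Finset.prod_mul_distrib]
  refine Finset.prod_congr rfl fun i _ => ?_
  have := signs_mul_self σ i
  by_cases h1 : i ∈ S <;> by_cases h2 : i ∈ T <;> simp [Finset.mem_symmDiff, h1, h2, this]

lemma signs_mul_chi {n : ℕ} (S : Finset (Fin n)) (i : Fin n) (σ : Fin n → Bool) :
    signs σ i * chi S σ = if i ∈ S then chi (S.erase i) σ else chi (insert i S) σ := by
  split_ifs with h
  · rw [chi, chi, ← Finset.mul_prod_erase _ _ h, ← mul_assoc, signs_mul_self, one_mul]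
  · rw [chi, chi, Finset.prod_insert h]

lemma evalML_eq {n : ℕ} (c : Finset (Fin n) → ℝ) (σ : Fin n → Bool) :
    evalML c (signs σ) = ∑ S, c S * chi S σ := rfl

/-! ### Expectations -/

lemma expOver_congr {n : ℕ} {A : Finset (Fin n → Bool)} {f g : (Fin n → Bool) → ℝ}
    (h : ∀ σ ∈ A, f σ = g σ) : expOver A f = expOver A g := by
  rw [expOver, expOver, Finset.sum_congr rfl h]

lemma expOver_add {n : ℕ} (A : Finset (Fin n → Bool)) (f g : (Fin n → Bool) → ℝ) :
    expOver A (fun σ => f σ + g σ) = expOver A f + expOver A g := by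
  simp [expOver, Finset.sum_add_distrib, add_div]

lemma expOver_const_mul {n : ℕ} (A : Finset (Fin n → Bool)) (r : ℝ) (f : (Fin n → Bool) → ℝ) :
    expOver A (fun σ => r * f σ) = r * expOver A f := by
  simp [expOver, ← Finset.mul_sum, mul_div_assoc]

lemma expOver_sum {n : ℕ} {ι : Type*} (A : Finset (Fin n → Bool)) (s : Finset ι)
    (f : ι → (Fin n → Bool) → ℝ) :
    expOver A (fun σ => ∑ j ∈ s, f j σ) = ∑ j ∈ s, expOver A (f j) := by
  simp only [expOver, Finset.sum_div]
  rw [Finset.sum_comm]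

lemma expOver_nonneg {n : ℕ} (A : Finset (Fin n → Bool)) {f : (Fin n → Bool) → ℝ}
    (h : ∀ σ, 0 ≤ f σ) : 0 ≤ expOver A f :=
  div_nonneg (Finset.sum_nonneg fun σ _ => h σ) (Nat.cast_nonneg _)

lemma expOver_comp_equiv {n : ℕ} (A : Finset (Fin n → Bool))
    (e : (Fin n → Bool) ≃ (Fin n → Bool)) (he : ∀ σ, e σ ∈ A ↔ σ ∈ A)
    (f : (Fin n → Bool) → ℝ) : expOver A (fun σ => f (e σ)) = expOver A f := by
  rw [expOver, expOver, Finset.sum_equiv e (fun σ => (he σ).symm) (fun σ _ => rfl)]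

lemma expOver_mul_sq_le {n : ℕ} (A : Finset (Fin n → Bool)) (f g : (Fin n → Bool) → ℝ) :
    expOver A (fun σ => f σ * g σ) ^ 2 ≤
      expOver A (fun σ => f σ ^ 2) * expOver A (fun σ => g σ ^ 2) := by
  simp only [expOver]
  rw [div_pow, div_mul_div_comm, ← sq]
  gcongr
  exact Finset.sum_mul_sq_le_sq_mul_sq _ _ _

/-! ### Hypercontractivity on the cube -/

/-- Negation of the coordinate `a`. -/
def flipEquiv {n : ℕ} (a : Fin n) : (Fin n → Bool) ≃ (Fin n → Bool) :=
  Equiv.piCongrRight fun i => if i = a then Equiv.boolNot else Equiv.refl _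

lemma signs_flipEquiv {n : ℕ} (a i : Fin n) (σ : Fin n → Bool) :
    signs (flipEquiv a σ) i = if i = a then -signs σ i else signs σ i := by
  by_cases h : i = a
  · subst h; cases hs : σ i <;> simp [signs, flipEquiv, hs]
  · simp [signs, flipEquiv, h]

lemma chi_flipEquiv {n : ℕ} {a : Fin n} {S : Finset (Fin n)} (h : a ∉ S) (σ : Fin n → Bool) :
    chi S (flipEquiv a σ) = chi S σ := by
  refine Finset.prod_congr rfl fun i hi => ?_
  rw [signs_flipEquiv, if_neg]
  rintro rfl; exact h hi

/-- Functions of degree at most `d` in the coordinates in `A`. -/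
def lowDeg {n : ℕ} (A : Finset (Fin n)) (d : ℕ) : Submodule ℝ ((Fin n → Bool) → ℝ) :=
  Submodule.span ℝ {F | ∃ S ⊆ A, S.card ≤ d ∧ chi S = F}

lemma chi_mem_lowDeg {n : ℕ} {A S : Finset (Fin n)} {d : ℕ} (h : S ⊆ A) (h' : S.card ≤ d) :
    chi S ∈ lowDeg A d := Submodule.subset_span ⟨S, h, h', rfl⟩

lemma lowDeg_flip {n : ℕ} {A : Finset (Fin n)} {d : ℕ} {a : Fin n} (ha : a ∉ A)
    {F : (Fin n → Bool) → ℝ} (hF : F ∈ lowDeg A d) (σ : Fin n → Bool) :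
    F (flipEquiv a σ) = F σ := by
  induction hF using Submodule.span_induction with
  | mem F hF =>
    obtain ⟨S, hS, -, rfl⟩ := hF
    exact chi_flipEquiv (fun h => ha (hS h)) σ
  | zero => rfl
  | add F G _ _ h1 h2 => simp [h1, h2]
  | smul r F _ h1 => simp [h1]

lemma lowDeg_empty {n : ℕ} {d : ℕ} {F : (Fin n → Bool) → ℝ} (hF : F ∈ lowDeg ∅ d) :
    ∃ r : ℝ, ∀ σ, F σ = r := by
  induction hF using Submodule.span_induction with
  | mem F hF =>
    obtain ⟨S, hS, -, rfl⟩ := hF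
    exact ⟨1, fun σ => by simp [Finset.subset_empty.1 hS, chi]⟩
  | zero => exact ⟨0, fun _ => rfl⟩
  | add F G _ _ h1 h2 =>
    obtain ⟨r, hr⟩ := h1; obtain ⟨s, hs⟩ := h2
    exact ⟨r + s, fun σ => by simp [hr, hs]⟩
  | smul t F _ h1 =>
    obtain ⟨r, hr⟩ := h1
    exact ⟨t * r, fun σ => by simp [hr]⟩

lemma lowDeg_zero_subset {n : ℕ} (A B : Finset (Fin n)) : lowDeg A 0 ≤ lowDeg B 0 := by
  refine Submodule.span_le.2 ?_
  rintro F ⟨S, hS, hc, rfl⟩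
  obtain rfl : S = ∅ := by simpa using hc
  exact chi_mem_lowDeg (by simp) (by simp)

lemma lowDeg_insert {n : ℕ} {A : Finset (Fin n)} {d : ℕ} {a : Fin n}
    {F : (Fin n → Bool) → ℝ} (hF : F ∈ lowDeg (insert a A) (d + 1)) :
    ∃ G ∈ lowDeg A (d + 1), ∃ H ∈ lowDeg A d, ∀ σ, F σ = G σ + signs σ a * H σ := by
  induction hF using Submodule.span_induction with
  | mem F hF =>
    obtain ⟨S, hS, hc, rfl⟩ := hF
    by_cases h : a ∈ S
    · refine ⟨0, zero_mem _, chi (S.erase a), chi_mem_lowDeg ?_ ?_, fun σ => ?_⟩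
      · exact Finset.subset_insert_iff.1 hS
      · rw [Finset.card_erase_of_mem h]; omega
      · simp [signs_mul_chi, Finset.insert_erase h]
    · refine ⟨chi S, chi_mem_lowDeg ?_ hc, 0, zero_mem _, fun σ => by simp⟩
      exact (Finset.subset_insert_iff_of_notMem h).1 hS
  | zero => exact ⟨0, zero_mem _, 0, zero_mem _, fun σ => by simp⟩
  | add F F' _ _ h1 h2 =>
    obtain ⟨G, hG, H, hH, h⟩ := h1
    obtain ⟨G', hG', H', hH', h'⟩ := h2
    refine ⟨G + G', add_mem hG hG', H + H', add_mem hH hH', fun σ => ?_⟩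
    simp only [Pi.add_apply, h, h']; ring
  | smul t F _ h1 =>
    obtain ⟨G, hG, H, hH, h⟩ := h1
    refine ⟨t • G, Submodule.smul_mem _ _ hG, t • H, Submodule.smul_mem _ _ hH, fun σ => ?_⟩
    simp only [Pi.smul_apply, smul_eq_mul, h]; ring

lemma lowDeg_mul {n : ℕ} {d e : ℕ} {F G : (Fin n → Bool) → ℝ}
    (hF : F ∈ lowDeg univ d) (hG : G ∈ lowDeg univ e) :
    (fun σ => F σ * G σ) ∈ lowDeg univ (d + e) := by
  change F * G ∈ _
  have h := Submodule.mul_mem_mul hF hG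
  rw [lowDeg, lowDeg, Submodule.span_mul_span] at h
  refine Submodule.span_le.2 ?_ h
  rintro _ ⟨_, ⟨S, -, hS, rfl⟩, _, ⟨T, -, hT, rfl⟩, rfl⟩
  have : (fun x1 x2 => x1 * x2) (chi S) (chi T) = chi (symmDiff S T) := by
    funext σ; exact chi_mul S T σ
  rw [SetLike.mem_coe, this]
  refine chi_mem_lowDeg (Finset.subset_univ _) ?_
  calc (symmDiff S T).card ≤ (S ∪ T).card := Finset.card_le_card (by
        intro i; simp only [Finset.mem_symmDiff, Finset.mem_union]; tauto)
    _ ≤ S.card + T.card := Finset.card_union_le _ _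
    _ ≤ d + e := by omega

lemma expOver_flip_average {n : ℕ} (a : Fin n) (f : (Fin n → Bool) → ℝ) :
    expOver univ f = expOver univ (fun σ => (f σ + f (flipEquiv a σ)) / 2) := by
  have h := expOver_comp_equiv univ (flipEquiv a) (by simp) f
  have h2 := expOver_add univ f (fun σ => f (flipEquiv a σ))
  have h3 := expOver_const_mul univ (1 / 2) (fun σ => f σ + f (flipEquiv a σ))
  rw [h2, h] at h3
  rw [show (fun σ => (f σ + f (flipEquiv a σ)) / 2) =
    fun σ => 1 / 2 * (f σ + f (flipEquiv a σ)) by funext σ; ring, h3]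
  ring

/-- Bonami's lemma on the cube. -/
lemma expOver_univ_pow_four_le {n : ℕ} (A : Finset (Fin n)) :
    ∀ (d : ℕ) (F : (Fin n → Bool) → ℝ), F ∈ lowDeg A d →
      expOver univ (fun σ => F σ ^ 4) ≤ 9 ^ d * expOver univ (fun σ => F σ ^ 2) ^ 2 := by
  induction A using Finset.induction_on with
  | empty =>
    intro d F hF
    obtain ⟨r, hr⟩ := lowDeg_empty hF
    have h1 : (1 : ℝ) ≤ 9 ^ d := one_le_pow₀ (by norm_num)
    simp only [hr, expOver, Finset.sum_const, nsmul_eq_mul]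
    rw [mul_div_cancel_left₀ _ (by simp), mul_div_cancel_left₀ _ (by simp)]
    nlinarith [sq_nonneg (r ^ 2)]
  | insert a A ha ih =>
    intro d F hF
    obtain _ | d := d
    · exact ih 0 F (lowDeg_zero_subset _ _ hF)
    obtain ⟨G, hG, H, hH, hFGH⟩ := lowDeg_insert hF
    have hs : ∀ σ : Fin n → Bool, signs σ a ^ 2 = 1 := fun σ => by rw [sq, signs_mul_self]
    have hFf : ∀ σ, F (flipEquiv a σ) = G σ - signs σ a * H σ := fun σ => by
      rw [hFGH, lowDeg_flip ha hG, lowDeg_flip ha hH, signs_flipEquiv, if_pos rfl]; ring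
    have e4 : expOver univ (fun σ => F σ ^ 4) = expOver univ (fun σ => G σ ^ 4) +
        6 * expOver univ (fun σ => G σ ^ 2 * H σ ^ 2) + expOver univ (fun σ => H σ ^ 4) := by
      rw [expOver_flip_average a, ← expOver_const_mul, ← expOver_add, ← expOver_add]
      refine expOver_congr fun σ _ => ?_
      rw [hFf, hFGH]
      linear_combination (6 * G σ ^ 2 * H σ ^ 2 + H σ ^ 4 * (signs σ a ^ 2 + 1)) * hs σ
    have e2 : expOver univ (fun σ => F σ ^ 2) = expOver univ (fun σ => G σ ^ 2) +
        expOver univ (fun σ => H σ ^ 2) := by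
      rw [expOver_flip_average a, ← expOver_add]
      refine expOver_congr fun σ _ => ?_
      rw [hFf, hFGH]
      linear_combination (H σ ^ 2) * hs σ
    have g4 := ih _ _ hG
    have h4 := ih _ _ hH
    have cs := expOver_mul_sq_le univ (fun σ => G σ ^ 2) (fun σ => H σ ^ 2)
    simp only [← pow_mul] at cs
    norm_num only at cs
    have pg : 0 ≤ expOver univ (fun σ => G σ ^ 2) := expOver_nonneg _ fun σ => sq_nonneg _
    have ph : 0 ≤ expOver univ (fun σ => H σ ^ 2) := expOver_nonneg _ fun σ => sq_nonneg _
    have ph4 : 0 ≤ expOver univ (fun σ => H σ ^ 4) := expOver_nonneg _ fun σ => by positivity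
    rw [e4, e2]
    generalize expOver univ (fun σ => G σ ^ 2) = g at *
    generalize expOver univ (fun σ => H σ ^ 2) = h at *
    have mixed : expOver univ (fun σ => G σ ^ 2 * H σ ^ 2) ≤ 3 * 9 ^ d * (g * h) := by
      refine le_of_sq_le_sq ?_ (by positivity)
      calc _ ≤ _ := cs
        _ ≤ (9 ^ (d + 1) * g ^ 2) * (9 ^ d * h ^ 2) := by gcongr
        _ = _ := by ring
    have p9 : (0 : ℝ) < 9 ^ d := by positivity
    rw [pow_succ] at *
    nlinarith [mul_nonneg p9.le (sq_nonneg h)]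

/-! ### Fourier analysis on the cube -/

lemma expOver_univ_chi {n : ℕ} (S : Finset (Fin n)) :
    expOver univ (chi S) = if S = ∅ then 1 else 0 := by
  split_ifs with h
  · subst h; simp [expOver, chi]
  · obtain ⟨a, ha⟩ := Finset.nonempty_iff_ne_empty.2 h
    rw [expOver_flip_average a]
    have : ∀ σ, chi S (flipEquiv a σ) = -chi S σ := fun σ => by
      have h1 : a ∉ S.erase a := by simp
      rw [← Finset.insert_erase ha]
      simp only [chi, Finset.prod_insert h1]
      have := chi_flipEquiv h1 σ
      simp only [chi] at this
      rw [this, signs_flipEquiv, if_pos rfl]; ring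
    simp [this, expOver]

lemma expOver_sq {n : ℕ} (A : Finset (Fin n → Bool)) (c : Finset (Fin n) → ℝ) :
    expOver A (fun σ => (∑ S, c S * chi S σ) ^ 2) =
      ∑ S, ∑ T, c S * c T * expOver A (chi (symmDiff S T)) := by
  simp only [← expOver_const_mul, ← expOver_sum]
  refine expOver_congr fun σ _ => ?_
  rw [sq, Finset.sum_mul_sum]
  refine Finset.sum_congr rfl fun S _ => Finset.sum_congr rfl fun T _ => ?_
  rw [← chi_mul]; ring

lemma expOver_univ_sq {n : ℕ} (c : Finset (Fin n) → ℝ) :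
    expOver univ (fun σ => (∑ S, c S * chi S σ) ^ 2) = ∑ S, c S ^ 2 := by
  rw [expOver_sq]
  refine Finset.sum_congr rfl fun S _ => ?_
  simp [expOver_univ_chi, ← Finset.bot_eq_empty, symmDiff_eq_bot, sq]

/-- The expectation over `A` of a function of degree at most `D` is controlled by its `L²` norm on
the cube. -/
lemma sq_expOver_le {n : ℕ} (A : Finset (Fin n → Bool)) (D : ℕ) {F : (Fin n → Bool) → ℝ}
    (hF : F ∈ lowDeg univ D) :
    expOver A F ^ 2 ≤ (∑ T : Finset (Fin n), if T.card ≤ D then expOver A (chi T) ^ 2 else 0) *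
      expOver univ (fun σ => F σ ^ 2) := by
  set c : Finset (Fin n) → ℝ := fun T => if T.card ≤ D then expOver A (chi T) else 0 with hc
  have key : expOver A F = expOver univ (fun σ => (∑ S, c S * chi S σ) * F σ) := by
    induction hF using Submodule.span_induction with
    | mem F hF =>
      obtain ⟨S, hS, hD, rfl⟩ := hF
      simp only [Finset.sum_mul, mul_assoc, chi_mul]
      rw [expOver_sum]
      simp only [expOver_const_mul]
      change _ = ∑ T, c T * expOver univ (chi (symmDiff T S))
      simp [expOver_univ_chi, ← Finset.bot_eq_empty, symmDiff_eq_bot, hc, hD]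
    | zero => simp [expOver]
    | add F G _ _ h1 h2 =>
      simp only [Pi.add_apply, mul_add]
      rw [expOver_add, ← h1, ← h2]
      exact expOver_add _ _ _
    | smul r F _ h1 =>
      simp only [Pi.smul_apply, smul_eq_mul, mul_left_comm _ r]
      rw [expOver_const_mul, ← h1]
      exact expOver_const_mul _ _ _
  rw [key]
  refine (expOver_mul_sq_le _ _ _).trans_eq ?_
  rw [expOver_univ_sq]
  simp [hc, ite_pow]

/-! ### Moments of the bisection distribution -/

lemma sum_signs_eq_zero {n : ℕ} {σ : Fin n → Bool} (h : σ ∈ bisSet n) : ∑ i, signs σ i = 0 := by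
  have h : intSum σ = 0 := (Finset.mem_filter.1 h).2
  have := congrArg (Int.cast : ℤ → ℝ) h
  simpa [intSum, signs] using this

lemma bisSet_nonempty {n : ℕ} (hn : Even n) : (bisSet n).Nonempty := by
  obtain ⟨m, rfl⟩ := hn
  refine ⟨Fin.append (fun _ : Fin m => true) (fun _ : Fin m => false), ?_⟩
  refine Finset.mem_filter.2 ⟨Finset.mem_univ _, ?_⟩
  rw [intSum, Fin.sum_univ_add]
  simp only [Fin.append_left, Fin.append_right]
  simp

/-- On the bisections, raising and lowering a parity function are opposite. -/
lemma sum_chi_insert {n : ℕ} (T : Finset (Fin n)) {σ : Fin n → Bool} (h : σ ∈ bisSet n) :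
    ∑ i ∈ Tᶜ, chi (insert i T) σ = -∑ i ∈ T, chi (T.erase i) σ := by
  have h0 : ∑ i, signs σ i * chi T σ = 0 := by
    rw [← Finset.sum_mul, sum_signs_eq_zero h, zero_mul]
  rw [← Finset.sum_add_sum_compl T] at h0
  rw [Finset.sum_congr rfl (g := fun i => chi (T.erase i) σ) (s₁ := T) (by
      intro i hi; rw [signs_mul_chi, if_pos hi]),
    Finset.sum_congr rfl (g := fun i => chi (insert i T) σ) (s₁ := Tᶜ) (by
      intro i hi; rw [signs_mul_chi, if_neg (Finset.mem_compl.1 hi)])] at h0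
  linarith

lemma expOver_chi_insert_congr {n : ℕ} {T : Finset (Fin n)} {i j : Fin n} (hi : i ∉ T)
    (hj : j ∉ T) :
    expOver (bisSet n) (chi (insert i T)) = expOver (bisSet n) (chi (insert j T)) := by
  rw [← expOver_comp_equiv (bisSet n) ((Equiv.swap i j).arrowCongr (Equiv.refl Bool))
    (f := chi (insert j T))]
  · refine expOver_congr fun σ _ => ?_
    simp only [chi, Finset.prod_insert hi, Finset.prod_insert hj]
    congr 1
    · simp [signs, Equiv.arrowCongr]
    · refine Finset.prod_congr rfl fun k hk => ?_
      have h1 : k ≠ i := by rintro rfl; exact hi hk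
      have h2 : k ≠ j := by rintro rfl; exact hj hk
      simp [signs, Equiv.arrowCongr, Equiv.swap_apply_of_ne_of_ne h1 h2]
  · intro σ
    have : intSum (((Equiv.swap i j).arrowCongr (Equiv.refl Bool)) σ) = intSum σ :=
      Equiv.sum_comp (Equiv.swap i j) fun k => if σ k then (1 : ℤ) else -1
    simp only [bisSet, Finset.mem_filter, Finset.mem_univ, true_and, this]

/-- The expectation of a parity of `t` coordinates over the bisections of `n` coordinates. -/
noncomputable def bisMoment (n : ℕ) : ℕ → ℝ
  | 0 => 1
  | 1 => 0
  | t + 2 => -((t + 1 : ℝ) / (n - (t + 1))) * bisMoment n t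

lemma expOver_chi_insert {n : ℕ} {T : Finset (Fin n)} {i : Fin n} (hi : i ∉ T) :
    ((n : ℝ) - T.card) * expOver (bisSet n) (chi (insert i T)) =
      -∑ j ∈ T, expOver (bisSet n) (chi (T.erase j)) := by
  have h : expOver (bisSet n) (fun σ => ∑ i ∈ Tᶜ, chi (insert i T) σ) =
      expOver (bisSet n) (fun σ => -1 * ∑ i ∈ T, chi (T.erase i) σ) :=
    expOver_congr fun σ hσ => by rw [sum_chi_insert T hσ]; ring
  rw [expOver_sum, expOver_const_mul, expOver_sum] at h
  have h2 : ∀ j ∈ Tᶜ, expOver (bisSet n) (fun σ => chi (insert j T) σ) =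
      expOver (bisSet n) (chi (insert i T)) := fun j hj =>
    expOver_chi_insert_congr (Finset.mem_compl.1 hj) hi
  rw [Finset.sum_congr rfl h2, Finset.sum_const, Finset.card_compl, Fintype.card_fin,
    nsmul_eq_mul, Nat.cast_sub (by simpa using Finset.card_le_univ T)] at h
  rw [h, neg_one_mul]

lemma expOver_bisSet_chi {n : ℕ} (hn : Even n) :
    ∀ (t : ℕ) (T : Finset (Fin n)), T.card = t → expOver (bisSet n) (chi T) = bisMoment n t
  | 0, T, hT => by
    obtain rfl : T = ∅ := Finset.card_eq_zero.1 hT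
    have := (bisSet_nonempty hn).card_pos
    simp [expOver, chi, bisMoment, this.ne']
  | 1, T, hT => by
    obtain ⟨i, rfl⟩ := Finset.card_eq_one.1 hT
    have h := expOver_chi_insert (T := ∅) (i := i) (by simp)
    have hn0 : (n : ℝ) ≠ 0 := Nat.cast_ne_zero.2 (by have := i.2; omega)
    simpa [hn0, bisMoment] using h
  | t + 2, T, hT => by
    obtain ⟨i, hi⟩ : T.Nonempty := Finset.card_pos.1 (by omega)
    have hc : (T.erase i).card = t + 1 := by rw [Finset.card_erase_of_mem hi]; omega
    have h := expOver_chi_insert (T := T.erase i) (i := i) (by simp)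
    have hle : t + 2 ≤ n := by
      rw [← hT]; simpa using Finset.card_le_univ T
    have hpos : (0 : ℝ) < n - (t + 1) := by
      have : ((t + 2 : ℕ) : ℝ) ≤ n := by exact_mod_cast hle
      push_cast at this; linarith
    rw [Finset.sum_congr rfl (g := fun _ => bisMoment n t) (by
        intro j hj
        exact expOver_bisSet_chi hn t _ (by rw [Finset.card_erase_of_mem hj]; omega)),
      Finset.insert_erase hi, Finset.sum_const, hc, nsmul_eq_mul] at h
    push_cast at h
    rw [bisMoment]
    field_simp
    linarith

lemma bisMoment_sign (n : ℕ) : ∀ j : ℕ, 2 * j ≤ n → 0 ≤ (-1) ^ j * bisMoment n (2 * j)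
  | 0, _ => by simp [bisMoment]
  | j + 1, h => by
    have ih := bisMoment_sign n j (by omega)
    have hpos : (0 : ℝ) < n - ((2 * j : ℕ) + 1) := by
      have : ((2 * (j + 1) : ℕ) : ℝ) ≤ n := by exact_mod_cast h
      push_cast at this ⊢; linarith
    rw [show 2 * (j + 1) = 2 * j + 2 by ring, bisMoment, pow_succ]
    have : (0 : ℝ) ≤ ((2 * j : ℕ) + 1) / (n - ((2 * j : ℕ) + 1)) := by positivity
    calc (0 : ℝ) ≤ (((2 * j : ℕ) + 1) / (n - ((2 * j : ℕ) + 1))) *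
          ((-1) ^ j * bisMoment n (2 * j)) := mul_nonneg this ih
      _ = _ := by ring

lemma choose_mul_bisMoment_sq_le (n : ℕ) :
    ∀ t : ℕ, 2 * t ≤ n → (n.choose t : ℝ) * bisMoment n t ^ 2 ≤ 1
  | 0, _ => by simp [bisMoment]
  | 1, _ => by simp [bisMoment]
  | t + 2, h => by
    have ih := choose_mul_bisMoment_sq_le n t (by omega)
    have hR : (2 * (t + 2) : ℝ) ≤ n := by exact_mod_cast h
    have c1 := Nat.choose_succ_right_eq n t
    have c2 := Nat.choose_succ_right_eq n (t + 1)
    have c1' := congrArg (Nat.cast : ℕ → ℝ) c1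
    have c2' := congrArg (Nat.cast : ℕ → ℝ) c2
    rw [Nat.cast_mul, Nat.cast_mul, Nat.cast_sub (by omega)] at c1' c2'
    push_cast at c1' c2'
    have ht : (0 : ℝ) ≤ t := Nat.cast_nonneg t
    have hp1 : (0 : ℝ) < n - (t + 1) := by linarith
    have e1 : (n.choose (t + 1) : ℝ) = n.choose t * (n - t) / (t + 1) := by
      field_simp; linarith
    have e2 : (n.choose (t + 2) : ℝ) =
        n.choose t * (n - t) / (t + 1) * (n - (t + 1)) / (t + 2) := by
      rw [← e1]; field_simp; rw [show t + 2 = t + 1 + 1 by ring]; linarith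
    rw [e2, bisMoment]
    calc _ = ((n - t) * (t + 1) / ((n - (t + 1)) * (t + 2))) *
          ((n.choose t : ℝ) * bisMoment n t ^ 2) := by field_simp
      _ ≤ 1 * 1 := by
        gcongr
        rw [div_le_one (by positivity)]
        nlinarith
      _ = 1 := one_mul 1

lemma sum_sq_expOver_chi_le {n : ℕ} (hn : Even n) (D : ℕ) (hD : 2 * D ≤ n) :
    (∑ T : Finset (Fin n), if T.card ≤ D then expOver (bisSet n) (chi T) ^ 2 else 0) ≤ D + 1 := by
  have h1 : ∀ T : Finset (Fin n), (if T.card ≤ D then expOver (bisSet n) (chi T) ^ 2 else 0) =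
      (fun t : ℕ => if t ≤ D then bisMoment n t ^ 2 else 0) T.card := fun T => by
    simp only [expOver_bisSet_chi hn _ T rfl]
  rw [Finset.sum_congr rfl fun T _ => h1 T, ← Finset.powerset_univ,
    Finset.sum_powerset_apply_card fun t : ℕ => if t ≤ D then bisMoment n t ^ 2 else 0]
  simp only [Finset.card_univ, Fintype.card_fin, nsmul_eq_mul]
  calc _ ≤ ∑ t ∈ Finset.range (n + 1), if t < D + 1 then (1 : ℝ) else 0 := by
        refine Finset.sum_le_sum fun t _ => ?_
        by_cases h : t ≤ D
        · rw [if_pos h, if_pos (by omega)]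
          exact choose_mul_bisMoment_sq_le n t (by omega)
        · rw [if_neg h, if_neg (by omega), mul_zero]
    _ ≤ ∑ t ∈ Finset.range (D + 1), (1 : ℝ) := by
        rw [← Finset.sum_filter]
        refine Finset.sum_le_sum_of_subset_of_nonneg ?_ (fun _ _ _ => zero_le_one)
        intro t; simp
    _ = D + 1 := by simp

/-! ### Harmonic representatives -/

/-- Coefficient families annihilated by the lowering operator `∑ i, ∂ / ∂x i`. -/
def IsHarmonic {n : ℕ} (c : Finset (Fin n) → ℝ) : Prop :=
  ∀ A, ∑ i ∈ Aᶜ, c (insert i A) = 0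

lemma exists_isHarmonic {n : ℕ} (d : ℕ) :
    ∀ c : Finset (Fin n) → ℝ, (∀ S, d < S.card → c S = 0) →
      ∃ c' : Finset (Fin n) → ℝ, (∀ S, d < S.card → c' S = 0) ∧ IsHarmonic c' ∧
        ∀ σ ∈ bisSet n, ∑ S, c S * chi S σ = ∑ S, c' S * chi S σ := by
  induction d with
  | zero =>
    intro c hc
    refine ⟨c, hc, fun A => Finset.sum_eq_zero fun i _ => hc _ ?_, fun _ _ => rfl⟩
    exact Finset.card_pos.2 (Finset.insert_nonempty _ _)
  | succ d ih =>
    intro c hc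
    let u : Finset (Fin n) → EuclideanSpace ℝ (Finset (Fin n)) := fun A =>
      ∑ i ∈ Aᶜ, EuclideanSpace.single (insert i A) (1 : ℝ)
    let K := Submodule.span ℝ {v | ∃ A : Finset (Fin n), A.card ≤ d ∧ u A = v}
    obtain ⟨k, hk, h, hh, hsum⟩ := K.exists_add_mem_mem_orthogonal (WithLp.toLp 2 c)
    have hKdeg : ∀ S, d + 1 < S.card → k S = 0 := by
      intro S hS
      clear hsum
      induction hk using Submodule.span_induction with
      | mem v hv =>
        obtain ⟨A, hA, rfl⟩ := hv
        simp only [u, WithLp.ofLp_sum, Finset.sum_apply]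
        refine Finset.sum_eq_zero fun i _ => ?_
        have : S ≠ insert i A := by
          rintro rfl
          have := Finset.card_insert_le i A
          omega
        simp [this]
      | zero => rfl
      | add v w _ _ h1 h2 => simp [h1, h2]
      | smul r v _ h1 => simp [h1]
    have hKred : ∃ c' : Finset (Fin n) → ℝ, (∀ S, d < S.card → c' S = 0) ∧
        ∀ σ ∈ bisSet n, ∑ S, k S * chi S σ = ∑ S, c' S * chi S σ := by
      clear hsum hKdeg
      induction hk using Submodule.span_induction with
      | mem v hv =>
        obtain ⟨A, hA, rfl⟩ := hv
        refine ⟨fun S => -∑ i ∈ A, if S = A.erase i then 1 else 0, fun S hS => ?_, fun σ hσ => ?_⟩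
        · rw [neg_eq_zero]
          refine Finset.sum_eq_zero fun i _ => if_neg ?_
          rintro rfl
          have := Finset.card_erase_le (s := A) (a := i)
          omega
        · have e1 : ∑ S, u A S * chi S σ = ∑ i ∈ Aᶜ, chi (insert i A) σ := by
            simp only [u, WithLp.ofLp_sum, Finset.sum_apply, Finset.sum_mul]
            rw [Finset.sum_comm]
            refine Finset.sum_congr rfl fun i _ => ?_
            simp
          rw [e1, sum_chi_insert A hσ]
          simp only [neg_mul, Finset.sum_neg_distrib, Finset.sum_mul]
          rw [Finset.sum_comm]
          simp
      | zero => exact ⟨0, fun _ _ => rfl, fun _ _ => by simp⟩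
      | add v w _ _ h1 h2 =>
        obtain ⟨a, ha, ha'⟩ := h1
        obtain ⟨b, hb, hb'⟩ := h2
        refine ⟨a + b, fun S hS => by simp [ha S hS, hb S hS], fun σ hσ => ?_⟩
        simp [add_mul, Finset.sum_add_distrib, ha' σ hσ, hb' σ hσ]
      | smul r v _ h1 =>
        obtain ⟨a, ha, ha'⟩ := h1
        refine ⟨r • a, fun S hS => by simp [ha S hS], fun σ hσ => ?_⟩
        simp [mul_assoc, ← Finset.mul_sum, ha' σ hσ]
    have hc' : ∀ S, c S = k S + h S := fun S => by
      have := congrArg (fun v : EuclideanSpace ℝ (Finset (Fin n)) => v S) hsum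
      simpa using this
    have hhdeg : ∀ S, d + 1 < S.card → h S = 0 := fun S hS => by
      have := hc' S
      rw [hc S hS, hKdeg S hS] at this
      linarith
    have hhharm : IsHarmonic (fun S => h S) := by
      intro A
      by_cases hA : A.card ≤ d
      · have := (Submodule.mem_orthogonal _ _).1 hh (u A) (Submodule.subset_span ⟨A, hA, rfl⟩)
        simpa [u, sum_inner, EuclideanSpace.inner_single_left] using this
      · refine Finset.sum_eq_zero fun i hi => hhdeg _ ?_
        rw [Finset.card_insert_of_notMem (Finset.mem_compl.1 hi)]; omega
    obtain ⟨a, ha, hak⟩ := hKred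
    obtain ⟨b, hb, hbharm, hab⟩ := ih a ha
    refine ⟨fun S => h S + b S, fun S hS => ?_, fun A => ?_, fun σ hσ => ?_⟩
    · simp [hhdeg S hS, hb S (by omega)]
    · rw [Finset.sum_add_distrib, hhharm A, hbharm A, add_zero]
    · simp only [hc', add_mul, Finset.sum_add_distrib, hak σ hσ, hab σ hσ]
      ring

section Homogeneous

variable {n k : ℕ} {c : Finset (Fin n) → ℝ}

lemma IsHarmonic.homogeneous (hc : IsHarmonic c) (k : ℕ) :
    IsHarmonic fun R => if R.card = k then c R else 0 := by
  intro A
  by_cases h : A.card + 1 = k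
  · rw [← hc A]
    refine Finset.sum_congr rfl fun i hi => ?_
    exact if_pos (by rwa [Finset.card_insert_of_notMem (Finset.mem_compl.1 hi)])
  · refine Finset.sum_eq_zero fun i hi => if_neg ?_
    rwa [Finset.card_insert_of_notMem (Finset.mem_compl.1 hi)]

lemma IsHarmonic.sum_superset (hc : IsHarmonic c) (hk : ∀ R, R.card ≠ k → c R = 0) :
    ∀ (m : ℕ) (A : Finset (Fin n)), A.card + m + 1 = k → ∑ R with A ⊆ R, c R = 0 := by
  have key : ∀ A : Finset (Fin n), ∑ i ∈ Aᶜ, ∑ R with insert i A ⊆ R, c R =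
      ((k : ℝ) - A.card) * ∑ R with A ⊆ R, c R := by
    intro A
    simp only [Finset.sum_filter, Finset.mul_sum]
    rw [Finset.sum_comm]
    refine Finset.sum_congr rfl fun R _ => ?_
    by_cases hAR : A ⊆ R
    · by_cases hR : R.card = k
      · have : ∀ i, insert i A ⊆ R ↔ i ∈ R := fun i => by
          rw [Finset.insert_subset_iff]; tauto
        simp only [this, if_pos hAR]
        rw [← Finset.sum_filter, Finset.sum_const, nsmul_eq_mul]
        congr 1
        have e : Aᶜ.filter (· ∈ R) = R \ A := by ext i; simp [and_comm]
        rw [e, Finset.card_sdiff_of_subset hAR, Nat.cast_sub (Finset.card_le_card hAR), hR]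
      · simp [hk R hR]
    · have : ∀ i, ¬ insert i A ⊆ R := fun i h => hAR ((Finset.subset_insert _ _).trans h)
      simp [this, hAR]
  have key2 : ∀ A : Finset (Fin n), A.card < k → ∑ i ∈ Aᶜ, ∑ R with insert i A ⊆ R, c R = 0 →
      ∑ R with A ⊆ R, c R = 0 := fun A hA h => by
    rw [key] at h
    have : (A.card : ℝ) < k := by exact_mod_cast hA
    exact (mul_eq_zero.1 h).resolve_left (by linarith)
  intro m
  induction m with
  | zero =>
    intro A hA
    refine key2 A (by omega) ?_
    rw [← hc A]
    refine Finset.sum_congr rfl fun i hi => ?_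
    have hci := Finset.card_insert_of_notMem (Finset.mem_compl.1 hi)
    rw [Finset.sum_eq_single_of_mem (insert i A) (by simp)]
    intro R hR hne
    refine hk R fun hRk => hne ?_
    exact (Finset.eq_of_subset_of_card_le (Finset.mem_filter.1 hR).2 (by omega)).symm
  | succ m ih =>
    intro A hA
    refine key2 A (by omega) (Finset.sum_eq_zero fun i hi => ih _ ?_)
    rw [Finset.card_insert_of_notMem (Finset.mem_compl.1 hi)]; omega

lemma sum_superset_disjoint (hz : ∀ A : Finset (Fin n), A.card < k → ∑ R with A ⊆ R, c R = 0)
    (hk : ∀ R, R.card ≠ k → c R = 0) (B : Finset (Fin n)) :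
    ∀ A, Disjoint A B → A.card + B.card ≤ k →
      ∑ R with A ⊆ R ∧ Disjoint B R, c R =
        if A.card + B.card = k then (-1) ^ B.card * c (A ∪ B) else 0 := by
  induction B using Finset.induction_on with
  | empty =>
    intro A _ hle
    simp only [Finset.disjoint_empty_left, and_true, Finset.card_empty, add_zero, pow_zero,
      one_mul, Finset.union_empty]
    split_ifs with h
    · rw [Finset.sum_eq_single_of_mem A (by simp)]
      intro R hR hne
      refine hk R fun hRk => hne ?_
      exact (Finset.eq_of_subset_of_card_le (Finset.mem_filter.1 hR).2 (by omega)).symm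
    · exact hz A (by simp at hle; omega)
  | insert b B hb ih =>
    intro A hdis hle
    rw [Finset.disjoint_insert_right] at hdis
    rw [Finset.card_insert_of_notMem hb] at hle ⊢
    have split : ∑ R with A ⊆ R ∧ Disjoint B R, c R =
        ∑ R with insert b A ⊆ R ∧ Disjoint B R, c R +
        ∑ R with A ⊆ R ∧ Disjoint (insert b B) R, c R := by
      simp only [Finset.sum_filter]
      rw [← Finset.sum_add_distrib]
      refine Finset.sum_congr rfl fun R _ => ?_
      simp only [Finset.insert_subset_iff, Finset.disjoint_insert_left]
      by_cases h1 : b ∈ R <;> by_cases h2 : A ⊆ R <;> by_cases h3 : Disjoint B R <;>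
        simp [h1, h2, h3]
    have i1 := ih A hdis.2 (by omega)
    have i2 := ih (insert b A) (Finset.disjoint_insert_left.2 ⟨hb, hdis.2⟩)
      (by rw [Finset.card_insert_of_notMem hdis.1]; omega)
    rw [Finset.card_insert_of_notMem hdis.1] at i2
    rw [if_neg (by omega)] at i1
    rw [i1, i2] at split
    rw [Finset.insert_union] at split
    rw [Finset.union_insert]
    by_cases h : A.card + (B.card + 1) = k
    · rw [if_pos h]
      rw [if_pos (by omega)] at split
      rw [pow_succ]; linarith
    · rw [if_neg h]
      rw [if_neg (by omega)] at split
      linarith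

/-- A function of the distance acts on homogeneous harmonic coefficients as a scalar. -/
lemma sum_mul_card_symmDiff (hc : IsHarmonic c) (hk : ∀ R, R.card ≠ k → c R = 0) (e : ℕ → ℝ)
    (T : Finset (Fin n)) (hT : T.card ≤ k) :
    ∑ R, c R * e (symmDiff T R).card =
      if T.card = k then (∑ A ∈ T.powerset, (-1) ^ (T \ A).card * e (2 * (T \ A).card)) * c T
      else 0 := by
  have hz : ∀ A : Finset (Fin n), A.card < k → ∑ R with A ⊆ R, c R = 0 := fun A hA =>
    hc.sum_superset hk (k - A.card - 1) A (by omega)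
  have hcard : ∀ A ∈ T.powerset, A.card + (T \ A).card = T.card := fun A hA => by
    have := Finset.card_sdiff_add_card_eq_card (Finset.mem_powerset.1 hA)
    omega
  have fiber : ∀ A ∈ T.powerset, ∑ R with T ∩ R = A, c R * e (symmDiff T R).card =
      e (T.card + k - 2 * A.card) *
        if T.card = k then (-1) ^ (T \ A).card * c T else 0 := by
    intro A hA
    have hAT := Finset.mem_powerset.1 hA
    have h := sum_superset_disjoint hz hk (T \ A) A Finset.disjoint_sdiff
      (by rw [hcard A hA]; exact hT)
    rw [hcard A hA, Finset.union_sdiff_of_subset hAT] at h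
    rw [← h, Finset.mul_sum]
    have hset : ∀ R, T ∩ R = A ↔ A ⊆ R ∧ Disjoint (T \ A) R := by
      intro R
      constructor
      · rintro rfl
        refine ⟨Finset.inter_subset_right, ?_⟩
        rw [Finset.sdiff_inter_self_left]
        exact Finset.sdiff_disjoint
      · rintro ⟨h1, h2⟩
        ext i
        rw [Finset.mem_inter]
        refine ⟨fun ⟨hi, hi'⟩ => ?_, fun hi => ⟨hAT hi, h1 hi⟩⟩
        by_contra hiA
        exact Finset.disjoint_left.1 h2 (Finset.mem_sdiff.2 ⟨hi, hiA⟩) hi'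
    simp only [← hset]
    refine Finset.sum_congr rfl fun R hR => ?_
    by_cases hRk : R.card = k
    · have hTR : T ∩ R = A := (Finset.mem_filter.1 hR).2
      have : (symmDiff T R).card = T.card + k - 2 * A.card := by
        have h1 := Finset.card_sdiff_add_card_inter T R
        have h2 := Finset.card_sdiff_add_card_inter R T
        rw [Finset.inter_comm R T, hTR] at h2
        rw [hTR] at h1
        rw [symmDiff_def, Finset.sup_eq_union, Finset.card_union_of_disjoint disjoint_sdiff_sdiff]
        omega
      rw [this, mul_comm]
    · simp [hk R hRk]
  rw [← Finset.sum_fiberwise_of_maps_to (s := univ) (t := T.powerset) (g := fun R => T ∩ R)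
    (fun R _ => Finset.mem_powerset.2 Finset.inter_subset_left), Finset.sum_congr rfl fiber]
  split_ifs with h
  · rw [Finset.sum_mul]
    refine Finset.sum_congr rfl fun A hA => ?_
    have := hcard A hA
    rw [show T.card + k - 2 * A.card = 2 * (T \ A).card by omega]
    ring
  · simp

end Homogeneous

/-- Passing from the cube to the bisections does not decrease the `L²` norm of a harmonic
polynomial. -/
lemma IsHarmonic.sum_sq_le {n d : ℕ} (hn : Even n) (hd : 2 * d ≤ n) {c : Finset (Fin n) → ℝ}
    (hdeg : ∀ S, d < S.card → c S = 0) (hc : IsHarmonic c) :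
    ∑ S, c S ^ 2 ≤ expOver (bisSet n) (fun σ => (∑ S, c S * chi S σ) ^ 2) := by
  have hsum : ∀ (T : Finset (Fin n)) (k : ℕ), T.card ≤ k →
      ∑ R, (if R.card = k then c R else 0) * bisMoment n (symmDiff T R).card =
      if T.card = k then (∑ A ∈ T.powerset, (-1) ^ (T \ A).card *
        bisMoment n (2 * (T \ A).card)) * c T else 0 := by
    intro T k hT
    rw [sum_mul_card_symmDiff (hc.homogeneous k) (fun R hR => if_neg hR) (bisMoment n) T hT]
    split_ifs <;> rfl
  have hlt : ∀ T, ∑ R, (if T.card < R.card then c R * bisMoment n (symmDiff T R).card else 0)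
      = 0 := by
    intro T
    have : ∀ R : Finset (Fin n),
        (if T.card < R.card then c R * bisMoment n (symmDiff T R).card else 0) =
        ∑ k ∈ Finset.Ioc T.card n, (if R.card = k then c R else 0) *
          bisMoment n (symmDiff T R).card := by
      intro R
      have hR : R.card ≤ n := by simpa using Finset.card_le_univ R
      rw [← Finset.sum_mul, Finset.sum_ite_eq]
      simp [hR]
    rw [Finset.sum_congr rfl fun R _ => this R, Finset.sum_comm]
    refine Finset.sum_eq_zero fun k hk => ?_
    have := (Finset.mem_Ioc.1 hk).1
    rw [hsum T k this.le, if_neg this.ne]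
  rw [expOver_sq]
  simp only [fun S T => expOver_bisSet_chi hn _ (symmDiff S T) rfl]
  have split : ∀ T R : Finset (Fin n), c T * c R * bisMoment n (symmDiff T R).card =
      c T * (if T.card < R.card then c R * bisMoment n (symmDiff T R).card else 0) +
      c T * ((if R.card = T.card then c R else 0) * bisMoment n (symmDiff T R).card) +
      c R * (if R.card < T.card then c T * bisMoment n (symmDiff R T).card else 0) := by
    intro T R
    rw [symmDiff_comm R T]
    rcases lt_trichotomy T.card R.card with h | h | h
    · simp [h, h.ne', h.le, mul_assoc]
    · simp [h, mul_assoc]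
    · simp [h, h.ne, h.not_gt]; ring
  simp only [split, Finset.sum_add_distrib]
  rw [Finset.sum_comm (f := fun T R : Finset (Fin n) =>
    c R * (if R.card < T.card then c T * bisMoment n (symmDiff R T).card else 0))]
  simp only [← Finset.mul_sum, hlt, mul_zero, Finset.sum_const_zero, add_zero, zero_add]
  refine Finset.sum_le_sum fun T _ => ?_
  rw [hsum T _ le_rfl, if_pos rfl]
  by_cases hT : d < T.card
  · simp [hdeg T hT]
  · have hge : 1 ≤ ∑ A ∈ T.powerset, (-1) ^ (T \ A).card * bisMoment n (2 * (T \ A).card) := by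
      have h1 := Finset.single_le_sum
        (f := fun A => (-1) ^ (T \ A).card * bisMoment n (2 * (T \ A).card)) (s := T.powerset)
        (fun A _ => bisMoment_sign n _ (by
          have := Finset.card_le_card (Finset.sdiff_subset (s := T) (t := A)); omega))
        (Finset.mem_powerset_self T)
      simpa [bisMoment] using h1
    nlinarith [sq_nonneg (c T)]

theorem stmt3 (d : ℕ) (hd : 1 ≤ d) :
    ∃ n₀ : ℕ, ∀ n : ℕ, n₀ ≤ n → Even n →
      ∀ c : Finset (Fin n) → ℝ, (∀ S, d < S.card → c S = 0) →
        expOver (bisSet n) (fun σ => (evalML c (signs σ)) ^ 4) ≤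
          12 * (d : ℝ) * 9 ^ (2 * d) *
            (expOver (bisSet n) (fun σ => (evalML c (signs σ)) ^ 2)) ^ 2 := by
  refine ⟨8 * d, fun n hn heven c₀ hc₀ => ?_⟩
  obtain ⟨c, hdeg, hharm, hagree⟩ := exists_isHarmonic d c₀ hc₀
  set F : (Fin n → Bool) → ℝ := fun σ => ∑ S, c S * chi S σ with hF
  have hcongr : ∀ m : ℕ, expOver (bisSet n) (fun σ => (evalML c₀ (signs σ)) ^ m) =
      expOver (bisSet n) (fun σ => F σ ^ m) := fun m =>
    expOver_congr fun σ hσ => by rw [evalML_eq, hagree σ hσ]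
  rw [hcongr, hcongr]
  have hFmem : F ∈ lowDeg univ d := by
    have : F = ∑ S, c S • chi S := by funext σ; simp [hF]
    rw [this]
    refine Submodule.sum_mem _ fun S _ => ?_
    by_cases hS : d < S.card
    · rw [hdeg S hS, zero_smul]; exact zero_mem _
    · exact Submodule.smul_mem _ _ (chi_mem_lowDeg (Finset.subset_univ _) (not_lt.1 hS))
  have hF2 : (fun σ => F σ ^ 2) ∈ lowDeg univ (2 * d) := by
    simpa only [sq, two_mul] using lowDeg_mul hFmem hFmem
  have hF4 : (fun σ => F σ ^ 4) ∈ lowDeg univ (4 * d) := by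
    have h := lowDeg_mul hF2 hF2
    simp only [← pow_add] at h
    rwa [show 2 * d + 2 * d = 4 * d by ring] at h
  have hcube : expOver univ (fun σ => F σ ^ 2) ≤ expOver (bisSet n) (fun σ => F σ ^ 2) := by
    rw [expOver_univ_sq]
    exact hharm.sum_sq_le heven (by omega) hdeg
  have b4 := expOver_univ_pow_four_le univ d F hFmem
  have b8 := expOver_univ_pow_four_le univ (2 * d) _ hF2
  simp only [← pow_mul] at b8
  have hmain := sq_expOver_le (bisSet n) (4 * d) hF4
  simp only [← pow_mul] at hmain
  norm_num only at b8 hmain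
  have hL := sum_sq_expOver_chi_le heven (4 * d) (by omega)
  have p2 : 0 ≤ expOver univ (fun σ => F σ ^ 2) := expOver_nonneg _ fun σ => by positivity
  have p4 : 0 ≤ expOver univ (fun σ => F σ ^ 4) := expOver_nonneg _ fun σ => by positivity
  have p8 : 0 ≤ expOver univ (fun σ => F σ ^ 8) := expOver_nonneg _ fun σ => by positivity
  have hdR : (1 : ℝ) ≤ d := by exact_mod_cast hd
  refine le_of_sq_le_sq ?_ (by positivity)
  calc _ ≤ _ := hmain
    _ ≤ (((4 * d : ℕ) : ℝ) + 1) * (9 ^ (2 * d) *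
          (9 ^ d * expOver univ (fun σ => F σ ^ 2) ^ 2) ^ 2) := by
        gcongr
        exact b8.trans (by gcongr)
    _ ≤ (12 * d) ^ 2 * (9 ^ (2 * d) *
          (9 ^ d * expOver (bisSet n) (fun σ => F σ ^ 2) ^ 2) ^ 2) := by
        gcongr
        push_cast
        nlinarith
    _ = _ := by ring
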